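/- (Second-moment bound in the intermediate regime with d₂/s₂² dominant.) Let α > 0. There exist constants c'_μ > 0 and C* ≥ 1 depending only on α such that the following holds for all positive integers d₁, d₂, all integers 1 ≤ s₁ < d₁/2, 1 ≤ s₂ ≤ d₂, and every c̄ ∈ (0,(2e)^{−4}) with s₁² ≤ c̄·d₁·s₂ and s₂²/d₂ ≥ 2e·s₁²/d₁: if max(1, ⌈C*·s₁²/d₁⌉) ≤ min( ⌊ C*·(s₂²/d₂)/log(d₁s₂²/(s₁²d₂)) ⌋, s₁ ) and μ > 0 satisfies μ² ≤ c'_μ·(d₂/s₂²)·log( max( C*/(2e), d₁/(2e·s₁²) ) ), then E[ exp(μ²·X·Y)·1( max(1, C*·s₁²/d₁) ≤ X ≤ min( C*·(s₂²/d₂)/log(d₁s₂²/(s₁²d₂)), s₁ ) ) ] < α. -/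

import Mathlib

/-- The binomial point mass: P(X = k) for X ~ Binomial(n, p). -/
noncomputable def binomP (n : ℕ) (p : ℝ) (k : ℕ) : ℝ :=
  (n.choose k : ℝ) * p ^ k * (1 - p) ^ (n - k)

/-- Expectation E[f(X,Y)] for independent X ~ Binomial(s₁, s₁/d₁) and
Y ~ Binomial(s₂, s₂/d₂). -/
noncomputable def Eexp (s₁ s₂ d₁ d₂ : ℕ) (f : ℕ → ℕ → ℝ) : ℝ :=
  ∑ k ∈ Finset.range (s₁ + 1), ∑ l ∈ Finset.range (s₂ + 1),
    binomP s₁ ((s₁ : ℝ) / (d₁ : ℝ)) k * binomP s₂ ((s₂ : ℝ) / (d₂ : ℝ)) l * f k l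

lemma binomP_nonneg {n : ℕ} {p : ℝ} (hp0 : 0 ≤ p) (hp1 : p ≤ 1) (k : ℕ) : 0 ≤ binomP n p k := by
  have : 0 ≤ 1 - p := sub_nonneg.2 hp1
  unfold binomP
  positivity

/-- Chernoff-type point mass bound `P(X = k) ≤ (e n p / k) ^ k`. -/
lemma binomP_le_pow {n k : ℕ} {p : ℝ} (hp0 : 0 ≤ p) (hp1 : p ≤ 1) (hk : 0 < k) :
    binomP n p k ≤ (Real.exp 1 * (n * p) / k) ^ k := by
  have hk' : (0 : ℝ) < k := by exact_mod_cast hk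
  have h1 : binomP n p k ≤ (n : ℝ) ^ k / k.factorial * p ^ k := by
    unfold binomP
    have h := Nat.choose_le_pow_div (α := ℝ) k n
    have h2 : (1 - p) ^ (n - k) ≤ 1 := pow_le_one₀ (sub_nonneg.2 hp1) (by linarith)
    calc (n.choose k : ℝ) * p ^ k * (1 - p) ^ (n - k) ≤ (n.choose k : ℝ) * p ^ k * 1 := by gcongr
      _ ≤ _ := by rw [mul_one]; gcongr
  have h3 : (k : ℝ) ^ k / k.factorial ≤ Real.exp 1 ^ k := by
    have := Real.pow_div_factorial_le_exp (k : ℝ) hk'.le k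
    rwa [← Real.exp_nat_mul, mul_one]
  calc binomP n p k ≤ (n : ℝ) ^ k / k.factorial * p ^ k := h1
    _ = ((k : ℝ) ^ k / k.factorial) * ((n * p) ^ k / (k : ℝ) ^ k) := by
      rw [mul_pow]
      field_simp
    _ ≤ Real.exp 1 ^ k * ((n * p) ^ k / (k : ℝ) ^ k) := by gcongr
    _ = _ := by rw [div_pow, mul_pow (Real.exp 1), mul_div_assoc]

/-- The moment generating function of a binomial is dominated by the Poisson one. -/
lemma sum_binomP_mul_exp_le {n : ℕ} {p : ℝ} (hp0 : 0 ≤ p) (hp1 : p ≤ 1) (t : ℝ) :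
    ∑ l ∈ Finset.range (n + 1), binomP n p l * Real.exp (t * l) ≤
      Real.exp (n * p * (Real.exp t - 1)) := by
  have h : ∑ l ∈ Finset.range (n + 1), binomP n p l * Real.exp (t * l) =
      (p * Real.exp t + (1 - p)) ^ n := by
    rw [add_pow]
    refine Finset.sum_congr rfl fun l _ => ?_
    rw [binomP, mul_comm t, Real.exp_nat_mul, mul_pow]
    ring
  rw [h, mul_assoc, Real.exp_nat_mul]
  have := Real.add_one_le_exp (p * (Real.exp t - 1))
  have h1 : 0 ≤ 1 - p := sub_nonneg.2 hp1
  gcongr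
  linarith

lemma sum_range_geometric_tail_le {q : ℝ} (hq0 : 0 ≤ q) (hq : q ≤ 1 / 2) (n : ℕ) :
    ∑ k ∈ Finset.range n, q ^ (k + 1) ≤ 2 * q := by
  have h := geom_sum_mul q n
  have h2 : 0 ≤ ∑ k ∈ Finset.range n, q ^ k := Finset.sum_nonneg fun _ _ => by positivity
  have h3 : ∑ k ∈ Finset.range n, q ^ k ≤ 2 := by
    have := pow_nonneg hq0 n
    nlinarith
  simp_rw [pow_succ', ← Finset.mul_sum]
  nlinarith

/-- In the range `1 ≤ C b / log (b / a)`, both `log C` and `log (1 / a)` are controlled by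
`log (b / a)`. -/
lemma log_max_le_mul_log_div {a b C : ℝ} (ha : 0 < a) (hb : 0 < b) (hC : 2 * Real.exp 1 ≤ C)
    (hab : 2 * Real.exp 1 * a ≤ b) (h1 : 1 ≤ C * b / Real.log (b / a)) :
    1 ≤ Real.log (b / a) ∧
      Real.log (max (C / (2 * Real.exp 1)) (1 / (2 * Real.exp 1 * a))) ≤
        (1 + Real.log C) * Real.log (b / a) := by
  have he : 1 < Real.exp 1 := by simp
  have hC0 : 0 < C := by linarith
  have hL : 1 ≤ Real.log (b / a) := by
    rw [Real.le_log_iff_exp_le (by positivity), le_div_iff₀ ha]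
    nlinarith
  have hlC : 0 ≤ Real.log C := Real.log_nonneg (by linarith)
  refine ⟨hL, ?_⟩
  rcases max_choice (C / (2 * Real.exp 1)) (1 / (2 * Real.exp 1 * a)) with h | h <;> rw [h]
  · have : Real.log (C / (2 * Real.exp 1)) ≤ Real.log C := by
      apply Real.log_le_log (by positivity)
      apply div_le_self hC0.le
      linarith
    nlinarith
  · have h2 : 1 ≤ C * b := by
      rw [le_div_iff₀ (by linarith)] at h1
      linarith
    have : Real.log (1 / (2 * Real.exp 1 * a)) ≤ Real.log (C * (b / a)) := by
      apply Real.log_le_log (by positivity)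
      rw [← mul_div_assoc]
      gcongr
      nlinarith
    rw [Real.log_mul (by positivity) (by positivity)] at this
    nlinarith

/-- A point-mass bound times a moment generating function bound is a geometric term, when `R`
dominates `1 / (4 q²)`. -/
lemma pow_mul_exp_le_pow {q R x B k : ℝ} {m : ℕ} (hq : 0 < q) (hR : 1 / (4 * q ^ 2) ≤ R)
    (hx0 : 0 ≤ x) (hx : x * (2 * R) ≤ 1) (hk : k = m) (hB : B ≤ k * (Real.log R / 2)) :
    x ^ m * Real.exp B ≤ q ^ m := by
  subst hk
  have hR0 : 0 < R := lt_of_lt_of_le (by positivity) hR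
  have hw : Real.exp (Real.log R / 2) ^ 2 = R := by
    rw [← Real.exp_nat_mul]
    push_cast
    rw [mul_div_cancel₀ _ two_ne_zero, Real.exp_log hR0]
  set w := Real.exp (Real.log R / 2) with hw'
  have hw0 : 0 < w := Real.exp_pos _
  have hw1 : 1 / (2 * q) ≤ w := by
    apply le_of_sq_le_sq _ hw0.le
    rw [hw, div_pow, one_pow, mul_pow]
    norm_num at hR ⊢
    exact hR
  have hqw : 1 ≤ 2 * q * w := by
    rw [div_le_iff₀ (by positivity)] at hw1
    linarith
  have hxw : x * w ≤ q := by
    rw [← hw] at hx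
    by_contra! h
    nlinarith
  calc x ^ m * Real.exp B ≤ x ^ m * w ^ m := by
        rw [hw', ← Real.exp_nat_mul]
        gcongr
    _ = (x * w) ^ m := (mul_pow _ _ _).symm
    _ ≤ q ^ m := by gcongr

/-- Second-moment bound in the intermediate regime with d₂/s₂² dominant
(Lemma A.5). -/
theorem intermediate_regime_d2_dominant (α : ℝ) (hα : 0 < α) :
    ∃ cμ' Cs : ℝ, 0 < cμ' ∧ 1 ≤ Cs ∧
      ∀ (d₁ d₂ s₁ s₂ : ℕ), 0 < d₁ → 0 < d₂ →
        1 ≤ s₁ → 2 * s₁ < d₁ → 1 ≤ s₂ → s₂ ≤ d₂ →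
        ∀ cbar : ℝ, 0 < cbar → cbar < 1 / (2 * Real.exp 1) ^ 4 →
          (s₁ : ℝ) ^ 2 ≤ cbar * (d₁ : ℝ) * (s₂ : ℝ) →
          2 * Real.exp 1 * (s₁ : ℝ) ^ 2 / (d₁ : ℝ) ≤
            (s₂ : ℝ) ^ 2 / (d₂ : ℝ) →
          max 1 (⌈Cs * (s₁ : ℝ) ^ 2 / (d₁ : ℝ)⌉ : ℝ) ≤
            min (⌊Cs * ((s₂ : ℝ) ^ 2 / (d₂ : ℝ)) /
                Real.log ((d₁ : ℝ) * (s₂ : ℝ) ^ 2 /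
                  ((s₁ : ℝ) ^ 2 * (d₂ : ℝ)))⌋ : ℝ) (s₁ : ℝ) →
          ∀ μ : ℝ, 0 < μ →
            μ ^ 2 ≤ cμ' * ((d₂ : ℝ) / (s₂ : ℝ) ^ 2) *
              Real.log (max (Cs / (2 * Real.exp 1))
                ((d₁ : ℝ) / (2 * Real.exp 1 * (s₁ : ℝ) ^ 2))) →
            Eexp s₁ s₂ d₁ d₂ (fun k l =>
              Real.exp (μ ^ 2 * (k : ℝ) * (l : ℝ)) *
                (if max 1 (Cs * (s₁ : ℝ) ^ 2 / (d₁ : ℝ)) ≤ (k : ℝ) ∧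
                    (k : ℝ) ≤ min (Cs * ((s₂ : ℝ) ^ 2 / (d₂ : ℝ)) /
                      Real.log ((d₁ : ℝ) * (s₂ : ℝ) ^ 2 /
                        ((s₁ : ℝ) ^ 2 * (d₂ : ℝ)))) (s₁ : ℝ)
                  then (1 : ℝ) else 0)) < α := by
  have he : 1 < Real.exp 1 := by simp
  obtain ⟨q, hq0, hq1, hqα⟩ : ∃ q : ℝ, 0 < q ∧ q ≤ 1 / 2 ∧ 2 * q < α :=
    ⟨min (1 / 2) (α / 4), by positivity, min_le_left _ _, by
      have := min_le_right (1 / 2) (α / 4)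
      linarith⟩
  obtain ⟨C, hCdef⟩ : ∃ C : ℝ, C / (2 * Real.exp 1) = 1 / (4 * q ^ 2) :=
    ⟨1 / (4 * q ^ 2) * (2 * Real.exp 1), by field_simp⟩
  have hC : 2 * Real.exp 1 ≤ C := by
    have : 1 ≤ C / (2 * Real.exp 1) := by
      rw [hCdef, le_div_iff₀ (by positivity)]
      nlinarith
    rwa [le_div_iff₀ (by positivity), one_mul] at this
  have hC0 : 0 < C := by linarith
  have hK : 0 < 1 + Real.log C := by
    have := Real.log_nonneg (show 1 ≤ C by linarith)
    linarith
  obtain ⟨c, hc0, hc1, hc2⟩ : ∃ c : ℝ, 0 < c ∧ c ≤ 1 / 4 ∧ c * (C * (1 + Real.log C)) ≤ 1 :=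
    ⟨min (1 / 4) (1 / (C * (1 + Real.log C))), by positivity, min_le_left _ _, by
      rw [← le_div_iff₀ (by positivity)]
      exact min_le_right _ _⟩
  refine ⟨c, C, hc0, by linarith, ?_⟩
  intro d₁ d₂ s₁ s₂ hd₁ hd₂ hs₁ hsd₁ hs₂ hsd₂ _ _ _ _ hab _ μ _ hμ
  have hd₁' : (0 : ℝ) < d₁ := by exact_mod_cast hd₁
  have hd₂' : (0 : ℝ) < d₂ := by exact_mod_cast hd₂
  have hs₁' : (0 : ℝ) < s₁ := by exact_mod_cast hs₁
  have hs₂' : (0 : ℝ) < s₂ := by exact_mod_cast hs₂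
  have hp₁ : (s₁ : ℝ) / d₁ ≤ 1 := by
    rw [div_le_one hd₁']
    exact_mod_cast (by omega : s₁ ≤ d₁)
  have hp₂ : (s₂ : ℝ) / d₂ ≤ 1 := by
    rw [div_le_one hd₂']
    exact_mod_cast hsd₂
  obtain ⟨a, ha⟩ : ∃ a : ℝ, a = (s₁ : ℝ) ^ 2 / d₁ := ⟨_, rfl⟩
  obtain ⟨b, hb⟩ : ∃ b : ℝ, b = (s₂ : ℝ) ^ 2 / d₂ := ⟨_, rfl⟩
  have ha0 : 0 < a := by rw [ha]; positivity
  have hb0 : 0 < b := by rw [hb]; positivity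
  have e1 : (d₁ : ℝ) * (s₂ : ℝ) ^ 2 / ((s₁ : ℝ) ^ 2 * d₂) = b / a := by
    rw [ha, hb]
    field_simp
  have e2 : (d₁ : ℝ) / (2 * Real.exp 1 * (s₁ : ℝ) ^ 2) = 1 / (2 * Real.exp 1 * a) := by
    rw [ha]
    field_simp
  have e3 : (d₂ : ℝ) / (s₂ : ℝ) ^ 2 = 1 / b := by
    rw [hb]
    field_simp
  have e4 : (s₁ : ℝ) * (s₁ / d₁) = a := by
    rw [ha]
    ring
  have e5 : (s₂ : ℝ) * (s₂ / d₂) = b := by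
    rw [hb]
    ring
  rw [e2, e3] at hμ
  rw [mul_div_assoc, ← ha, ← hb] at hab
  rw [e1, ← hb, mul_div_assoc C, ← ha]
  set R := max (C / (2 * Real.exp 1)) (1 / (2 * Real.exp 1 * a)) with hR
  have hRC : 1 / (4 * q ^ 2) ≤ R := hCdef ▸ le_max_left _ _
  have key : ∀ k : ℕ, (∑ l ∈ Finset.range (s₂ + 1),
      binomP s₁ (s₁ / d₁) k * binomP s₂ (s₂ / d₂) l *
        (Real.exp (μ ^ 2 * (k : ℝ) * (l : ℝ)) *
          (if max 1 (C * a) ≤ (k : ℝ) ∧ (k : ℝ) ≤ min (C * b / Real.log (b / a)) (s₁ : ℝ)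
            then (1 : ℝ) else 0))) ≤ if k = 0 then 0 else q ^ k := by
    intro k
    split_ifs with h hk hk
    · subst hk
      exact absurd ((le_max_left _ _).trans h.1) (by norm_num)
    · obtain ⟨h1, h2⟩ := h
      have hk1 : (1 : ℝ) ≤ k := (le_max_left _ _).trans h1
      have hk2 : C * a ≤ k := (le_max_right _ _).trans h1
      have hk3 : (k : ℝ) ≤ C * b / Real.log (b / a) := h2.trans (min_le_left _ _)
      obtain ⟨hL, hRL⟩ := log_max_le_mul_log_div ha0 hb0 hC hab (hk1.trans hk3)
      rw [← hR] at hRL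
      have hμb : μ ^ 2 * b ≤ c * Real.log R := by
        calc μ ^ 2 * b ≤ c * (1 / b) * Real.log R * b := by gcongr
          _ = c * Real.log R := by field_simp
      have ht1 : μ ^ 2 * k ≤ 1 := by
        have hLpos : 0 < Real.log (b / a) := by linarith
        calc μ ^ 2 * k ≤ μ ^ 2 * (C * b / Real.log (b / a)) := by gcongr
          _ = μ ^ 2 * b * (C / Real.log (b / a)) := by ring
          _ ≤ c * ((1 + Real.log C) * Real.log (b / a)) * (C / Real.log (b / a)) := by
            gcongr ?_ * _
            exact hμb.trans (by gcongr)
          _ = c * (C * (1 + Real.log C)) := by field_simp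
          _ ≤ 1 := hc2
      have ht0 : 0 ≤ μ ^ 2 * k := by positivity
      have hexp : Real.exp (μ ^ 2 * k) - 1 ≤ 2 * (μ ^ 2 * k) := by
        have := Real.abs_exp_sub_one_le (x := μ ^ 2 * k) (by rwa [abs_of_nonneg ht0])
        rw [abs_of_nonneg ht0] at this
        exact (le_abs_self _).trans this
      have hlogR : 0 ≤ Real.log R := by
        by_contra! hneg
        nlinarith [mul_pos hc0 (neg_pos.2 hneg), mul_nonneg (sq_nonneg μ) hb0.le]
      have hB : b * (Real.exp (μ ^ 2 * k) - 1) ≤ k * (Real.log R / 2) := by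
        calc b * (Real.exp (μ ^ 2 * k) - 1) ≤ b * (2 * (μ ^ 2 * k)) := by gcongr
          _ = 2 * k * (μ ^ 2 * b) := by ring
          _ ≤ 2 * k * (1 / 4 * Real.log R) := by
            gcongr ?_ * ?_
            exact hμb.trans (by gcongr)
          _ = k * (Real.log R / 2) := by ring
      have hkR : 2 * Real.exp 1 * a * R ≤ k := by
        rw [hR]
        rcases max_choice (C / (2 * Real.exp 1)) (1 / (2 * Real.exp 1 * a)) with h | h <;> rw [h]
        · calc 2 * Real.exp 1 * a * (C / (2 * Real.exp 1)) = C * a := by field_simp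
            _ ≤ k := hk2
        · calc 2 * Real.exp 1 * a * (1 / (2 * Real.exp 1 * a)) = 1 := by field_simp
            _ ≤ k := hk1
      have hX := binomP_le_pow (n := s₁) (k := k) (p := s₁ / d₁) (by positivity) hp₁
        (Nat.pos_of_ne_zero hk)
      have hY := sum_binomP_mul_exp_le (n := s₂) (p := s₂ / d₂) (by positivity) hp₂ (μ ^ 2 * k)
      rw [e4] at hX
      rw [e5] at hY
      simp only [mul_one, mul_assoc (binomP s₁ _ k)]
      rw [← Finset.mul_sum]
      have hx : Real.exp 1 * a / k * (2 * R) ≤ 1 := by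
        rw [div_mul_eq_mul_div, div_le_one (by linarith)]
        linarith
      have hsum : 0 ≤ ∑ l ∈ Finset.range (s₂ + 1),
          binomP s₂ (s₂ / d₂) l * Real.exp (μ ^ 2 * k * l) :=
        Finset.sum_nonneg fun l _ =>
          mul_nonneg (binomP_nonneg (by positivity) hp₂ l) (Real.exp_pos _).le
      exact (mul_le_mul hX hY hsum (by positivity)).trans
        (pow_mul_exp_le_pow hq0 hRC (by positivity) hx rfl hB)
    · simp
    · simp only [mul_zero, Finset.sum_const_zero]
      positivity
  calc _ ≤ ∑ k ∈ Finset.range (s₁ + 1), (if k = 0 then 0 else q ^ k) :=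
        Finset.sum_le_sum fun k _ => key k
    _ = ∑ k ∈ Finset.range s₁, q ^ (k + 1) := by simp [Finset.sum_range_succ']
    _ ≤ 2 * q := sum_range_geometric_tail_le hq0.le hq1 s₁
    _ < α := hqα
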